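/- arXiv:2207.12719 — 2 statements merged into one kernel-verified Lean document; each statement's English description precedes it below -/
import Mathlib

section
/- Let C ⊆ M³ˣ³_sym be a nonempty closed convex set insensitive to hydrostatic pressure, λ > 0, μ > 0, H(τ) = 2μτ + λ tr(τ)I, T > 0, and let ε, ε^e, ε^p, σ : [0,T) → M³ˣ³_sym be continuously differentiable. Then the following are equivalent: (1) for all t ∈ [0,T): σ(t) ∈ C, ε̇(t) = ε̇^e(t) + ε̇^p(t), σ̇(t) = H(ε̇^e(t)), ε̇^p(t):σ(t) ≥ ε̇^p(t):σ* for all σ* ∈ C, and ε̇^p(t):σ̇(t) = 0; (2) σ(0) ∈ C and for all t ∈ [0,T): ε̇^e(t) = P_{T_C(σ(t))}(ε̇(t)), ε̇^p(t) = P_{N_C(σ(t))}(ε̇(t)), and σ̇(t) = P_{T_C(σ(t))}(H(ε̇(t))). Moreover, when these statements hold, for all t ∈ [0,T): σ̇(t) = H(ε̇(t)) − 2μ P_{N_C(σ(t))}(ε̇(t)), P_{N_C(σ(t))}(H(ε̇(t))) = 2μ P_{N_C(σ(t))}(ε̇(t)), ε̇^e(t):ε̇^p(t) = 0, and ‖ε̇(t)‖²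 = ‖ε̇^e(t)‖² + ‖ε̇^p(t)‖². -/
open Matrix

attribute [local instance] Matrix.frobeniusNormedAddCommGroup Matrix.frobeniusNormedSpace

/-- The space of 3×3 real matrices (we single out the symmetric ones by `Matrix.IsSymm`). -/
abbrev Mat3 := Matrix (Fin 3) (Fin 3) ℝ

/-- The Frobenius inner product on symmetric matrices: `σ:τ = tr(στ)`. -/
noncomputable def minner (A B : Mat3) : ℝ := (A * B).trace

/-- The Frobenius norm `‖A‖ = (A:A)^{1/2}` on symmetric matrices. -/
noncomputable def mnorm (A : Mat3) : ℝ := Real.sqrt (minner A A)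

/-- `p` is the metric (orthogonal) projection of `z` onto `K`. -/
def IsProjOn (K : Set Mat3) (z p : Mat3) : Prop :=
  p ∈ K ∧ ∀ w ∈ K, mnorm (z - p) ≤ mnorm (z - w)

/-- The tangent cone of a convex set `C` at `σ`. -/
def tangentCone (C : Set Mat3) (σ : Mat3) : Set Mat3 :=
  closure {τ | ∃ η ∈ C, ∃ α : ℝ, 0 < α ∧ τ = α • (η - σ)}

/-- The normal cone of a convex set `C ⊆ M³ˣ³_sym` at `σ`. -/
def normalCone (C : Set Mat3) (σ : Mat3) : Set Mat3 :=
  {n | n.IsSymm ∧ ∀ τ ∈ tangentCone C σ, minner n τ ≤ 0}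

/-- The Hooke (isotropic elasticity) operator `H(τ) = 2μτ + λ tr(τ) I`. -/
noncomputable def hooke (lam mu : ℝ) (τ : Mat3) : Mat3 :=
  (2 * mu) • τ + (lam * τ.trace) • (1 : Mat3)

/-- Statement (1): the classical laws of perfect elasto-plasticity hold on `[0,T)`:
yield criterion, additive decomposition of the strain rate, Hooke's law,
principle of maximum work, and the consistency condition. -/
noncomputable def ClassicalLaws (C : Set Mat3) (lam mu T : ℝ)
    (σ ε' εe' εp' σ' : ℝ → Mat3) : Prop :=
  ∀ t ∈ Set.Ico (0 : ℝ) T,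
    σ t ∈ C ∧
    ε' t = εe' t + εp' t ∧
    σ' t = hooke lam mu (εe' t) ∧
    (∀ σs ∈ C, minner (εp' t) σs ≤ minner (εp' t) (σ t)) ∧
    minner (εp' t) (σ' t) = 0

/-- Statement (2): the projection form of the elasto-plastic laws:
`σ(0) ∈ C`, `ε̇ᵉ = P_{T_C(σ)} ε̇`, `ε̇ᵖ = P_{N_C(σ)} ε̇` and `σ̇ = P_{T_C(σ)} H(ε̇)`. -/
noncomputable def ProjectionLaws (C : Set Mat3) (lam mu T : ℝ)
    (σ ε' εe' εp' σ' : ℝ → Mat3) : Prop :=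
  σ 0 ∈ C ∧
  ∀ t ∈ Set.Ico (0 : ℝ) T,
    IsProjOn (tangentCone C (σ t)) (ε' t) (εe' t) ∧
    IsProjOn (normalCone C (σ t)) (ε' t) (εp' t) ∧
    IsProjOn (tangentCone C (σ t)) (hooke lam mu (ε' t)) (σ' t)

section helpers

open Filter Topology

lemma mi_add_left (A B D : Mat3) : minner (A + B) D = minner A D + minner B D := by
  simp [minner, add_mul]
lemma mi_sub_left (A B D : Mat3) : minner (A - B) D = minner A D - minner B D := by
  simp [minner, sub_mul]
lemma mi_add_right (A B D : Mat3) : minner D (A + B) = minner D A + minner D B := by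
  simp [minner, mul_add]
lemma mi_sub_right (A B D : Mat3) : minner D (A - B) = minner D A - minner D B := by
  simp [minner, mul_sub]
lemma mi_smul_left (c : ℝ) (A D : Mat3) : minner (c • A) D = c * minner A D := by
  simp [minner]
lemma mi_smul_right (c : ℝ) (A D : Mat3) : minner D (c • A) = c * minner D A := by
  simp [minner]
lemma mi_comm (A D : Mat3) : minner A D = minner D A := by
  simp [minner, Matrix.trace_mul_comm A D]
lemma mi_one (A : Mat3) : minner A 1 = A.trace := by
  simp [minner]

lemma mi_expand (A B : Mat3) : minner A B = ∑ i, ∑ j, A i j * B j i := by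
  simp [minner, Matrix.trace, Matrix.mul_apply]

lemma mi_self_norm {A : Mat3} (h : A.IsSymm) : minner A A = ‖A‖ ^ 2 := by
  rw [mi_expand, Matrix.frobenius_norm_def, ← Real.rpow_natCast, ← Real.rpow_mul (by positivity)]
  norm_num
  refine Finset.sum_congr rfl fun i _ => Finset.sum_congr rfl fun j _ => ?_
  rw [h.apply i j, sq]

lemma mi_self_nonneg {A : Mat3} (h : A.IsSymm) : 0 ≤ minner A A := by
  rw [mi_self_norm h]; positivity

lemma mi_self_eq {A : Mat3} (h : A.IsSymm) (h0 : minner A A ≤ 0) : A = 0 := by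
  rw [mi_self_norm h] at h0
  have : ‖A‖ = 0 := by nlinarith [norm_nonneg A]
  simpa using this

lemma mnorm_le {A B : Mat3} (hB : B.IsSymm) : mnorm A ≤ mnorm B ↔ minner A A ≤ minner B B :=
  Real.sqrt_le_sqrt_iff (mi_self_nonneg hB)

lemma mnorm_sq {A : Mat3} (h : A.IsSymm) : mnorm A ^ 2 = minner A A :=
  Real.sq_sqrt (mi_self_nonneg h)

lemma mi_cont (n : Mat3) : Continuous (fun τ : Mat3 => minner n τ) := by
  unfold minner; fun_prop

lemma symm_closed : IsClosed {A : Mat3 | A.IsSymm} := by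
  unfold Matrix.IsSymm
  exact isClosed_eq (by fun_prop) (by fun_prop)

lemma tc_symm {C : Set Mat3} (hC : ∀ A ∈ C, A.IsSymm) {s : Mat3} (hs : s.IsSymm) :
    ∀ A ∈ tangentCone C s, A.IsSymm := by
  intro A hA
  refine closure_minimal (t := {A : Mat3 | A.IsSymm}) ?_ symm_closed hA
  rintro _ ⟨η, hη, α, -, rfl⟩
  exact ((hC η hη).sub hs).smul α

lemma tc_le {C : Set Mat3} {s n : Mat3} (h : ∀ η ∈ C, minner n (η - s) ≤ 0) :
    ∀ A ∈ tangentCone C s, minner n A ≤ 0 := by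
  intro A hA
  refine closure_minimal (t := {A : Mat3 | minner n A ≤ 0}) ?_
    (isClosed_le (mi_cont n) continuous_const) hA
  rintro _ ⟨η, hη, α, ha, rfl⟩
  have := h η hη
  simp only [Set.mem_ofPred_eq, mi_smul_right]
  nlinarith

lemma tc_shift {C : Set Mat3} (hh : ∀ A ∈ C, ∀ p : ℝ, A + p • (1 : Mat3) ∈ C) {s A : Mat3}
    (hA : A ∈ tangentCone C s) (p : ℝ) : A + p • (1 : Mat3) ∈ tangentCone C s := by
  refine map_mem_closure (f := fun A : Mat3 => A + p • (1 : Mat3)) (by fun_prop) hA ?_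
  rintro _ ⟨η, hη, α, ha, rfl⟩
  refine ⟨η + (p / α) • (1 : Mat3), hh η hη _, α, ha, ?_⟩
  have : p • (1 : Mat3) = α • ((p / α) • (1 : Mat3)) := by
    rw [smul_smul]; congr 1; field_simp
  simp only [this]
  module

lemma tc_smul {C : Set Mat3} {s A : Mat3}
    (hA : A ∈ tangentCone C s) {c : ℝ} (hc : 0 < c) : c • A ∈ tangentCone C s := by
  refine map_mem_closure (f := fun A : Mat3 => c • A) (by fun_prop) hA ?_
  rintro _ ⟨η, hη, α, ha, rfl⟩
  exact ⟨η, hη, c * α, by positivity, by simp [smul_smul]⟩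

lemma tc_add {C : Set Mat3} (hconv : Convex ℝ C) {s A B : Mat3}
    (hA : A ∈ tangentCone C s) (hB : B ∈ tangentCone C s) : A + B ∈ tangentCone C s := by
  refine map_mem_closure₂ (f := fun A B : Mat3 => A + B) (by fun_prop) hA hB ?_
  rintro _ ⟨η, hη, α, ha, rfl⟩ _ ⟨ξ, hξ, β, hb, rfl⟩
  refine ⟨(α / (α + β)) • η + (β / (α + β)) • ξ,
    hconv hη hξ (by positivity) (by positivity) (by field_simp), α + β, by positivity, ?_⟩
  have e1 : (α + β) * (α / (α + β)) = α := by field_simp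
  have e2 : (α + β) * (β / (α + β)) = β := by field_simp
  rw [smul_sub (α + β), smul_add (α + β), smul_smul, smul_smul, e1, e2]
  module

lemma tc_zero {C : Set Mat3} {s : Mat3} (hs : s ∈ C) : (0 : Mat3) ∈ tangentCone C s :=
  subset_closure ⟨s, hs, 1, one_pos, by simp⟩

lemma nc_trace {C : Set Mat3} (hh : ∀ A ∈ C, ∀ p : ℝ, A + p • (1 : Mat3) ∈ C) {s n : Mat3}
    (hs : s ∈ C) (hn : n ∈ normalCone C s) : n.trace = 0 := by
  have h1 := hn.2 _ (tc_shift hh (tc_zero hs) 1)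
  have h2 := hn.2 _ (tc_shift hh (tc_zero hs) (-1))
  rw [zero_add, mi_smul_right, mi_one] at h1 h2
  linarith

lemma nc_smul {C : Set Mat3} {s n : Mat3} (hn : n ∈ normalCone C s) {c : ℝ} (hc : 0 < c) :
    c • n ∈ normalCone C s := by
  refine ⟨hn.1.smul c, fun τ h => ?_⟩
  have := hn.2 τ h
  rw [mi_smul_left]; nlinarith

/-- Abstract projection lemma: `z = p + n`, `n ⟂ p`, `n : w ≤ 0` on `K`. -/
lemma proj_of {K : Set Mat3} (hK : ∀ A ∈ K, A.IsSymm) {p n : Mat3} (hp : p ∈ K) (hn : n.IsSymm)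
    (ho : minner n p = 0) (hle : ∀ w ∈ K, minner n w ≤ 0) : IsProjOn K (p + n) p := by
  refine ⟨hp, fun w hw => ?_⟩
  have hs : (p - w).IsSymm := (hK p hp).sub (hK w hw)
  rw [mnorm_le (((hK p hp).add hn).sub (hK w hw))]
  have e1 : p + n - p = n := by abel
  have e2 : p + n - w = n + (p - w) := by abel
  rw [e1, e2]
  have h1 := mi_self_nonneg hs
  have h2 := hle w hw
  have h3 : minner n (p - w) = minner n p - minner n w := mi_sub_right _ _ _
  have h4 := mi_comm (p - w) n
  rw [mi_add_left, mi_add_right, mi_add_right]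
  linarith

lemma proj_uniq {K : Set Mat3} (hK : ∀ A ∈ K, A.IsSymm) {p n q : Mat3} (hp : p ∈ K)
    (hn : n.IsSymm)
    (ho : minner n p = 0) (hle : ∀ w ∈ K, minner n w ≤ 0) (hq : IsProjOn K (p + n) q) :
    q = p := by
  obtain ⟨hqK, hq⟩ := hq
  have hq := hq p hp
  have hs : (p - q).IsSymm := (hK p hp).sub (hK q hqK)
  have e1 : p + n - p = n := by abel
  have e2 : p + n - q = n + (p - q) := by abel
  rw [e1, e2, mnorm_le hn] at hq
  have h2 := hle q hqK
  have h3 : minner n (p - q) = minner n p - minner n q := mi_sub_right _ _ _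
  have h4 := mi_comm (p - q) n
  rw [mi_add_left, mi_add_right, mi_add_right] at hq
  have := mi_self_eq hs (by linarith)
  exact (sub_eq_zero.mp this).symm

/-- elementary fact -/
lemma quad_aux {a b : ℝ} (h : ∀ s : ℝ, 0 < s → s ≤ 1 → 2 * s * a ≤ s ^ 2 * b) : a ≤ 0 := by
  by_contra hc
  push Not at hc
  have h1 := h (min 1 (a / (|b| + 1))) (by positivity) (min_le_left _ _)
  set s := min 1 (a / (|b| + 1)) with hs
  have hs0 : 0 < s := by positivity
  have h2 : s * (|b| + 1) ≤ a := by
    have := min_le_right 1 (a / (|b| + 1))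
    rw [← hs] at this
    rwa [le_div_iff₀ (by positivity)] at this
  have h3 : 2 * a ≤ s * b := by nlinarith
  nlinarith [le_abs_self b]

/-- variational inequality -/
lemma var_ineq {z p w : Mat3} (hz : z.IsSymm) (hp : p.IsSymm) (hw : w.IsSymm)
    (h : ∀ s : ℝ, 0 < s → s ≤ 1 → mnorm (z - p) ≤ mnorm (z - (p + s • w))) :
    minner (z - p) w ≤ 0 := by
  refine quad_aux (b := minner w w) fun s h0 h1 => ?_
  have := h s h0 h1
  rw [mnorm_le (hz.sub (hp.add (hw.smul s)))] at this
  have e : z - (p + s • w) = (z - p) - s • w := by abel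
  rw [e, mi_sub_left _ (s • w), mi_sub_right _ (s • w), mi_sub_right _ (s • w), mi_smul_left,
    mi_smul_left,
    mi_smul_right, mi_smul_right, mi_comm w (z - p)] at this
  nlinarith

/-- Moreau decomposition for the tangent cone. -/
lemma moreau {C : Set Mat3} (hC : ∀ A ∈ C, A.IsSymm) (hconv : Convex ℝ C) {s : Mat3} (hs : s ∈ C)
    {z p : Mat3} (hz : z.IsSymm) (hp : IsProjOn (tangentCone C s) z p) :
    z - p ∈ normalCone C s ∧ minner (z - p) p = 0 := by
  obtain ⟨hpK, hmin⟩ := hp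
  have hK := tc_symm hC (hC s hs)
  have key : ∀ w ∈ tangentCone C s, minner (z - p) w ≤ 0 := fun w hw =>
    var_ineq hz (hK p hpK) (hK w hw) fun a h0 h1 => hmin _ (tc_add hconv hpK (tc_smul hw h0))
  refine ⟨⟨hz.sub (hK p hpK), key⟩, le_antisymm (key p hpK) ?_⟩
  have : minner (z - p) (-p) ≤ 0 := by
    refine var_ineq hz (hK p hpK) (hK p hpK).neg fun a h0 h1 => hmin _ ?_
    rcases h1.lt_or_eq with h1 | rfl
    · have : p + a • (-p) = (1 - a) • p := by module
      rw [this]; exact tc_smul hpK (by linarith)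
    · simpa using tc_zero hs
  have e : -p = (-1 : ℝ) • p := by simp
  rw [e, mi_smul_right] at this
  linarith

lemma entry_deriv {f : ℝ → Mat3} {f' : Mat3} {S : Set ℝ} {t : ℝ} (h : HasDerivWithinAt f f' S t)
    (i j : Fin 3) : HasDerivWithinAt (fun u => f u i j) (f' i j) S t := by
  have := (LinearMap.toContinuousLinearMap
    (Matrix.entryLinearMap ℝ ℝ i j : Mat3 →ₗ[ℝ] ℝ)).hasFDerivAt.comp_hasDerivWithinAt t h
  exact this

lemma deriv_symm {T : ℝ} {f f' : ℝ → Mat3}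
    (h : ∀ t ∈ Set.Ico (0 : ℝ) T, HasDerivWithinAt f (f' t) (Set.Ico (0 : ℝ) T) t)
    (hs : ∀ t ∈ Set.Ico (0 : ℝ) T, (f t).IsSymm) : ∀ t ∈ Set.Ico (0 : ℝ) T, (f' t).IsSymm := by
  intro t ht
  refine Matrix.IsSymm.ext fun i j => ?_
  have h1 := entry_deriv (h t ht) i j
  have h2 := entry_deriv (h t ht) j i
  have h3 : HasDerivWithinAt (fun u => f u i j) (f' t j i) (Set.Ico (0 : ℝ) T) t :=
    h2.congr (fun u hu => ((hs u hu).apply i j).symm) ((hs t ht).apply i j).symm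
  exact (uniqueDiffOn_Ico 0 T t ht).eq_deriv _ h3 h1

lemma right_deriv {T : ℝ} {E : Type*} [NormedAddCommGroup E] [NormedSpace ℝ E] {f : ℝ → E} {f' : E}
    {t : ℝ} (ht : t ∈ Set.Ico (0 : ℝ) T)
    (h : HasDerivWithinAt f f' (Set.Ico (0 : ℝ) T) t) :
    Tendsto (slope f t) (𝓝[>] t) (𝓝 f') := by
  have h2 : HasDerivWithinAt f f' (Set.Ioi t) t := by
    refine h.mono_of_mem_nhdsWithin ?_
    filter_upwards [Ioo_mem_nhdsGT ht.2] with z hz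
    exact ⟨ht.1.trans hz.1.le, hz.2⟩
  exact (hasDerivWithinAt_iff_tendsto_slope' (by simp)).1 h2

lemma deriv_mem {C : Set Mat3} {T : ℝ} {f : ℝ → Mat3} {f' : Mat3} {t : ℝ}
    (ht : t ∈ Set.Ico (0 : ℝ) T)
    (hm : ∀ t ∈ Set.Ico (0 : ℝ) T, f t ∈ C)
    (h : HasDerivWithinAt f f' (Set.Ico (0 : ℝ) T) t) : f' ∈ tangentCone C (f t) := by
  refine mem_closure_of_tendsto (right_deriv ht h) ?_
  filter_upwards [Ioo_mem_nhdsGT ht.2] with z hz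
  exact ⟨f z, hm z ⟨ht.1.trans hz.1.le, hz.2⟩, (z - t)⁻¹, inv_pos.2 (sub_pos.2 hz.1), rfl⟩

lemma dist_deriv {f : ℝ → Mat3} {f' p : Mat3} {S : Set ℝ} {t : ℝ} (h : HasDerivWithinAt f f' S t) :
    HasDerivWithinAt (fun u => minner (f u - p) (f u - p)) (2 * minner (f t - p) f') S t := by
  have h1 : ∀ i j, HasDerivWithinAt (fun u => (f u - p) i j) (f' i j) S t := fun i j =>
    entry_deriv (h.sub_const p) i j
  have : HasDerivWithinAt (fun u => ∑ i, ∑ j, (f u - p) i j * (f u - p) j i)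
      (∑ i, ∑ j, (f' i j * (f t - p) j i + (f t - p) i j * f' j i)) S t :=
    HasDerivWithinAt.fun_sum fun i _ => HasDerivWithinAt.fun_sum fun j _ => (h1 i j).mul (h1 j i)
  simp only [mi_expand] at *
  convert this using 1
  simp only [Fin.sum_univ_three]
  ring

/-- Viability: the stress stays in `C`. -/
lemma viable {C : Set Mat3} (hC : ∀ A ∈ C, A.IsSymm) (hne : C.Nonempty) (hcl : IsClosed C)
    (hconv : Convex ℝ C) {T : ℝ} {f f' : ℝ → Mat3}
    (h : ∀ t ∈ Set.Ico (0 : ℝ) T, HasDerivWithinAt f (f' t) (Set.Ico (0 : ℝ) T) t)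
    (hs : ∀ t ∈ Set.Ico (0 : ℝ) T, (f t).IsSymm) (h0 : f 0 ∈ C)
    (hm : ∀ t ∈ Set.Ico (0 : ℝ) T, f' t ∈ tangentCone C (f t)) :
    ∀ t ∈ Set.Ico (0 : ℝ) T, f t ∈ C := by
  intro b hb
  have hsub : Set.Icc 0 b ⊆ Set.Ico (0 : ℝ) T := fun x hx => ⟨hx.1, hx.2.trans_lt hb.2⟩
  have : ProperSpace Mat3 := FiniteDimensional.proper ℝ Mat3
  have hfc : ContinuousOn f (Set.Icc 0 b) := fun x hx =>
    ((h x (hsub hx)).continuousWithinAt).mono hsub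
  have key : ∀ x ∈ Set.Icc 0 b, (Metric.infDist (f x) C) ^ 2 ≤ (fun _ : ℝ => (0 : ℝ)) x := by
    intro x hx
    refine image_le_of_liminf_slope_right_le_deriv_boundary
      (f := fun x => (Metric.infDist (f x) C) ^ 2) (a := 0) (b := b)
      (B := fun _ => (0 : ℝ)) (B' := fun _ => 0) ?_ ?_ ?_ ?_ ?_ hx
    · exact ((Metric.continuous_infDist_pt C).comp_continuousOn hfc).pow 2
    · simp [Metric.infDist_zero_of_mem h0]
    · exact continuousOn_const
    · intro x _; exact hasDerivWithinAt_const _ _ _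
    · intro x hx r hr
      have hxT : x ∈ Set.Ico 0 T := hsub ⟨hx.1, hx.2.le⟩
      obtain ⟨p, hpC, hp⟩ := hcl.exists_infDist_eq_dist hne (f x)
      have hmin : ∀ w ∈ C, mnorm (f x - p) ≤ mnorm (f x - w) := by
        intro w hw
        rw [mnorm_le ((hs x hxT).sub (hC w hw)), mi_self_norm ((hs x hxT).sub (hC w hw)),
          mi_self_norm ((hs x hxT).sub (hC p hpC)), ← dist_eq_norm, ← dist_eq_norm, ← hp]
        exact pow_le_pow_left₀ Metric.infDist_nonneg (Metric.infDist_le_dist_of_mem hw) 2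
      have hv : ∀ w ∈ C, minner (f x - p) (w - f x) ≤ 0 := by
        intro w hw
        have h1 : minner (f x - p) (w - p) ≤ 0 := by
          refine var_ineq (hs x hxT) (hC p hpC) ((hC w hw).sub (hC p hpC)) fun s h0 h1 => hmin _ ?_
          exact hconv.add_smul_sub_mem hpC hw ⟨h0.le, h1⟩
        have h2 := mi_self_nonneg ((hs x hxT).sub (hC p hpC))
        have e : w - f x = (w - p) - (f x - p) := by abel
        rw [e, mi_sub_right _ (f x - p)]
        linarith
      have hd := tc_le hv _ (hm x hxT)
      have ht := right_deriv hxT (dist_deriv (p := p) (h x hxT))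
      refine Eventually.frequently ?_
      filter_upwards [ht.eventually_lt_const (u := r) (by linarith), Ioo_mem_nhdsGT hxT.2]
        with z hz1 hz
      refine lt_of_le_of_lt ?_ hz1
      have hzT : z ∈ Set.Ico 0 T := ⟨hxT.1.trans hz.1.le, hz.2⟩
      simp only [slope_def_field]
      refine div_le_div_of_nonneg_right ?_ (sub_pos.2 hz.1).le
      rw [mi_self_norm ((hs x hxT).sub (hC p hpC)), mi_self_norm ((hs z hzT).sub (hC p hpC)),
        hp, ← dist_eq_norm, ← dist_eq_norm]
      exact sub_le_sub_right (pow_le_pow_left₀ Metric.infDist_nonneg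
        (Metric.infDist_le_dist_of_mem hpC) 2) _
  have := key b ⟨hb.1, le_rfl⟩
  have h2 : Metric.infDist (f b) C = 0 := by
    have := Metric.infDist_nonneg (x := f b) (s := C)
    simp only at *
    nlinarith
  exact (hcl.mem_iff_infDist_zero hne).2 h2

lemma hooke_add (l m : ℝ) (A B : Mat3) : hooke l m (A + B) = hooke l m A + hooke l m B := by
  simp only [hooke, Matrix.trace_add]; module

lemma hooke_dev (l m : ℝ) {A : Mat3} (h : A.trace = 0) : hooke l m A = (2 * m) • A := by
  simp [hooke, h]

end helpers

/-- Theorem 2.1: equivalence of the classical laws of perfect elasto-plasticity with the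
projection formulation, together with the supplementary identities. -/
theorem stmt3 (C : Set Mat3)
    (hCsym : ∀ A ∈ C, A.IsSymm) (hne : C.Nonempty) (hcl : IsClosed C) (hconv : Convex ℝ C)
    (hhydro : ∀ A ∈ C, ∀ p : ℝ, A + p • (1 : Mat3) ∈ C)
    (lam mu : ℝ) (hlam : 0 < lam) (hmu : 0 < mu)
    (T : ℝ) (hT : 0 < T)
    (ε εe εp σ ε' εe' εp' σ' : ℝ → Mat3)
    (hεd : ∀ t ∈ Set.Ico (0 : ℝ) T, HasDerivWithinAt ε (ε' t) (Set.Ico (0 : ℝ) T) t)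
    (hεed : ∀ t ∈ Set.Ico (0 : ℝ) T, HasDerivWithinAt εe (εe' t) (Set.Ico (0 : ℝ) T) t)
    (hεpd : ∀ t ∈ Set.Ico (0 : ℝ) T, HasDerivWithinAt εp (εp' t) (Set.Ico (0 : ℝ) T) t)
    (hσd : ∀ t ∈ Set.Ico (0 : ℝ) T, HasDerivWithinAt σ (σ' t) (Set.Ico (0 : ℝ) T) t)
    (hεc : ContinuousOn ε' (Set.Ico (0 : ℝ) T))
    (hεec : ContinuousOn εe' (Set.Ico (0 : ℝ) T))
    (hεpc : ContinuousOn εp' (Set.Ico (0 : ℝ) T))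
    (hσc : ContinuousOn σ' (Set.Ico (0 : ℝ) T))
    (hsymv : ∀ t ∈ Set.Ico (0 : ℝ) T,
      (ε t).IsSymm ∧ (εe t).IsSymm ∧ (εp t).IsSymm ∧ (σ t).IsSymm) :
    (ClassicalLaws C lam mu T σ ε' εe' εp' σ' ↔
      ProjectionLaws C lam mu T σ ε' εe' εp' σ') ∧
    (ClassicalLaws C lam mu T σ ε' εe' εp' σ' →
      ∀ t ∈ Set.Ico (0 : ℝ) T,
        ∀ pN : Mat3, IsProjOn (normalCone C (σ t)) (ε' t) pN →
          σ' t = hooke lam mu (ε' t) - (2 * mu) • pN ∧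
          IsProjOn (normalCone C (σ t)) (hooke lam mu (ε' t)) ((2 * mu) • pN) ∧
          minner (εe' t) (εp' t) = 0 ∧
          mnorm (ε' t) ^ 2 = mnorm (εe' t) ^ 2 + mnorm (εp' t) ^ 2) := by
  have hε's := deriv_symm hεd fun t ht => (hsymv t ht).1
  have hσs : ∀ t ∈ Set.Ico (0 : ℝ) T, (σ t).IsSymm := fun t ht => (hsymv t ht).2.2.2
  have hεps := deriv_symm hεpd fun t ht => (hsymv t ht).2.2.1
  -- consequences of the classical laws
  have main : ClassicalLaws C lam mu T σ ε' εe' εp' σ' → ∀ t ∈ Set.Ico (0 : ℝ) T,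
      εe' t ∈ tangentCone C (σ t) ∧ εp' t ∈ normalCone C (σ t) ∧ σ' t ∈ tangentCone C (σ t) ∧
      minner (εp' t) (εe' t) = 0 ∧ hooke lam mu (ε' t) = σ' t + (2 * mu) • εp' t := by
    intro hc t ht
    obtain ⟨hC, hsum, hH, hmax, hcons⟩ := hc t ht
    have hN : εp' t ∈ normalCone C (σ t) := by
      refine ⟨hεps t ht, tc_le fun η hη => ?_⟩
      have := hmax η hη
      rw [mi_sub_right]; linarith
    have hT' : σ' t ∈ tangentCone C (σ t) := deriv_mem ht (fun u hu => (hc u hu).1) (hσd t ht)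
    have htr := nc_trace hhydro hC hN
    refine ⟨?_, hN, hT', ?_, ?_⟩
    · have h1 := tc_smul (tc_shift hhydro hT' (-(lam * (εe' t).trace)))
        (c := (2 * mu)⁻¹) (by positivity)
      have e : (2 * mu)⁻¹ • (σ' t + (-(lam * (εe' t).trace)) • (1 : Mat3)) = εe' t := by
        rw [hH, hooke, neg_smul, add_neg_cancel_right, smul_smul, inv_mul_cancel₀ (by positivity),
          one_smul]
      rwa [e] at h1
    · rw [hH, hooke, mi_add_right, mi_smul_right, mi_smul_right, mi_one, htr] at hcons
      have h2 : 2 * mu * minner (εp' t) (εe' t) = 0 := by linarith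
      exact (mul_eq_zero.1 h2).resolve_left (by positivity)
    · rw [hsum, hooke_add, ← hH, hooke_dev _ _ htr]
  have ncs : ∀ t, ∀ A ∈ normalCone C (σ t), A.IsSymm := fun t A hA => hA.1
  refine ⟨⟨fun hc => ⟨(hc 0 ⟨le_rfl, hT⟩).1, fun t ht => ?_⟩, fun hp => ?_⟩, fun hc t ht pN hpN => ?_⟩
  · obtain ⟨h1, h2, h3, h4, h5⟩ := main hc t ht
    obtain ⟨hC, hsum, hH, hmax, hcons⟩ := hc t ht
    have tcs := tc_symm hCsym (hσs t ht)
    refine ⟨?_, ?_, ?_⟩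
    · rw [hsum]; exact proj_of tcs h1 h2.1 h4 h2.2
    · rw [hsum, add_comm]
      exact proj_of (ncs t) h2 (tcs _ h1) (by rw [mi_comm, h4])
        fun w hw => by rw [mi_comm]; exact hw.2 _ h1
    · rw [h5]
      exact proj_of tcs h3 (h2.1.smul _) (by rw [mi_smul_left, hcons, mul_zero])
        (nc_smul h2 (by positivity)).2
  · obtain ⟨h0, hp⟩ := hp
    have hmem := viable hCsym hne hcl hconv hσd hσs h0 fun t ht => (hp t ht).2.2.1
    intro t ht
    obtain ⟨h1, h2, h3⟩ := hp t ht
    have hC := hmem t ht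
    have tcs := tc_symm hCsym (hσs t ht)
    obtain ⟨m1, m2⟩ := moreau hCsym hconv hC (hε's t ht) h1
    have hep : εp' t = ε' t - εe' t := by
      refine proj_uniq (ncs t) (n := εe' t) m1 (tcs _ h1.1) (by rw [mi_comm, m2])
        (fun w hw => by rw [mi_comm]; exact hw.2 _ h1.1) ?_
      rwa [sub_add_cancel]
    rw [← hep] at m1 m2
    have hsum : ε' t = εe' t + εp' t := by rw [hep]; abel
    have htr := nc_trace hhydro hC m1
    have hHT : hooke lam mu (εe' t) ∈ tangentCone C (σ t) :=
      tc_shift hhydro (tc_smul h1.1 (by positivity)) _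
    have horth : minner (εp' t) (hooke lam mu (εe' t)) = 0 := by
      rw [hooke, mi_add_right, mi_smul_right, mi_smul_right, mi_one, htr, m2]; ring
    have hs' : σ' t = hooke lam mu (εe' t) := by
      refine proj_uniq tcs (n := (2 * mu) • εp' t) hHT (m1.1.smul _)
        (by rw [mi_smul_left, horth, mul_zero]) (nc_smul m1 (by positivity)).2 ?_
      rwa [← hooke_dev lam mu htr, ← hooke_add, ← hsum]
    refine ⟨hC, hsum, hs', fun η hη => ?_, by rw [hs', horth]⟩
    have := m1.2 (η - σ t) (subset_closure ⟨η, hη, 1, one_pos, by simp⟩)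
    rw [mi_sub_right] at this
    linarith
  · obtain ⟨h1, h2, h3, h4, h5⟩ := main hc t ht
    obtain ⟨hC, hsum, hH, hmax, hcons⟩ := hc t ht
    have tcs := tc_symm hCsym (hσs t ht)
    have hpe : pN = εp' t := by
      refine proj_uniq (ncs t) (n := εe' t) h2 (tcs _ h1) (by rw [mi_comm, h4])
        (fun w hw => by rw [mi_comm]; exact hw.2 _ h1) ?_
      rwa [add_comm, ← hsum]
    subst hpe
    refine ⟨by rw [h5]; abel, ?_, by rw [mi_comm, h4], ?_⟩
    · rw [h5, add_comm]
      exact proj_of (ncs t) (nc_smul h2 (by positivity)) (tcs _ h3)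
        (by rw [mi_smul_right, mi_comm, hcons, mul_zero])
        fun w hw => by rw [mi_comm]; exact hw.2 _ h3
    · rw [mnorm_sq (hε's t ht), mnorm_sq (tcs _ h1), mnorm_sq h2.1, hsum, mi_add_left,
        mi_add_right, mi_add_right, mi_comm (εe' t) (εp' t), h4]
      ring
end

section
/- Let k > 0 and C_T = {τ ∈ M³ˣ³_sym : λ₁(τ) − λ₃(τ) ≤ 2k}. Let σ ∈ M³ˣ³_sym with λ₁(σ) = λ₂(σ) > λ₃(σ) and λ₁(σ) − λ₃(σ) = 2k, and let v₃ be a unit eigenvector of σ for λ₃(σ). Then N_{C_T}(σ) = {κ − tr(κ)·v₃v₃ᵀ : κ ∈ M³ˣ³_sym, κ positive semidefinite, κσ = σκ}. -/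
open Matrix

/-- The set of (real) eigenvalues of `A`, i.e. the real roots of `det(A - t I) = 0`. -/
def eigSet (A : Mat3) : Set ℝ := {t : ℝ | (A - t • (1 : Mat3)).det = 0}

/-- The largest eigenvalue `λ₁(A)` of `A`. -/
noncomputable def lam1 (A : Mat3) : ℝ := sSup (eigSet A)

/-- The smallest eigenvalue `λ₃(A)` of `A`. -/
noncomputable def lam3 (A : Mat3) : ℝ := sInf (eigSet A)

/-- The middle eigenvalue `λ₂(A)` of `A` (recovered from the trace). -/
noncomputable def lam2 (A : Mat3) : ℝ := A.trace - lam1 A - lam3 A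


lemma eigSet_eq (A : Mat3) (hA : A.IsHermitian) : eigSet A = Set.range hA.eigenvalues := by
  rw [← hA.spectrum_real_eq_range_eigenvalues]
  ext t
  rw [spectrum.mem_iff, Matrix.isUnit_iff_isUnit_det, isUnit_iff_ne_zero, not_not, eigSet,
    Set.mem_ofPred_eq, ← neg_sub, Matrix.det_neg, Algebra.algebraMap_eq_smul_one]
  simp

lemma symm_herm {A : Mat3} (h : A.IsSymm) : A.IsHermitian := by
  rw [Matrix.IsHermitian, Matrix.conjTranspose_eq_transpose_of_trivial]; exact h

lemma eigSet_finite {A : Mat3} (h : A.IsSymm) : (eigSet A).Finite := by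
  rw [eigSet_eq A (symm_herm h)]; exact Set.finite_range _

lemma eigSet_nonempty {A : Mat3} (h : A.IsSymm) : (eigSet A).Nonempty := by
  rw [eigSet_eq A (symm_herm h)]; exact Set.range_nonempty _

lemma psd_of {A : Mat3} (h : A.IsSymm) (hq : ∀ t ∈ eigSet A, 0 ≤ t) : A.PosSemidef := by
  rw [(symm_herm h).posSemidef_iff_eigenvalues_nonneg]
  intro i
  exact hq _ (by rw [eigSet_eq A (symm_herm h)]; exact ⟨i, rfl⟩)

lemma eig_nonneg {A : Mat3} (h : A.PosSemidef) : ∀ t ∈ eigSet A, 0 ≤ t := by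
  intro t ht
  rw [eigSet_eq A h.1] at ht
  obtain ⟨i, rfl⟩ := ht
  exact h.1.posSemidef_iff_eigenvalues_nonneg.1 h i

lemma symm_smul_one (a : ℝ) : (a • (1 : Mat3)).IsSymm := by
  simp [Matrix.IsSymm]

lemma mem_eig_sub {A : Mat3} {a t : ℝ} : t ∈ eigSet (A - a • (1 : Mat3)) ↔ a + t ∈ eigSet A := by
  simp only [eigSet, Set.mem_ofPred_eq, add_smul, sub_sub]

lemma mem_eig_sub' {A : Mat3} {a t : ℝ} : t ∈ eigSet (a • (1 : Mat3) - A) ↔ a - t ∈ eigSet A := by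
  simp only [eigSet, Set.mem_ofPred_eq, sub_smul]
  rw [show a • (1 : Mat3) - A - t • (1 : Mat3) = -(A - (a • (1 : Mat3) - t • (1 : Mat3))) by abel,
    Matrix.det_neg]
  simp

lemma psd_lam1 {A : Mat3} (h : A.IsSymm) : (lam1 A • (1 : Mat3) - A).PosSemidef := by
  refine psd_of ((symm_smul_one _).sub h) fun t ht => ?_
  rw [mem_eig_sub'] at ht
  have := le_csSup (eigSet_finite h).bddAbove ht
  rw [← lam1] at this; linarith

lemma psd_lam3 {A : Mat3} (h : A.IsSymm) : (A - lam3 A • (1 : Mat3)).PosSemidef := by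
  refine psd_of (h.sub (symm_smul_one _)) fun t ht => ?_
  rw [mem_eig_sub] at ht
  have := csInf_le (eigSet_finite h).bddBelow ht
  rw [← lam3] at this; linarith

lemma band {A : Mat3} (h : A.IsSymm) {a b : ℝ} (h1 : (A - a • (1 : Mat3)).PosSemidef)
    (h2 : (b • (1 : Mat3) - A).PosSemidef) : lam1 A - lam3 A ≤ b - a := by
  have h3 : lam1 A ≤ b := csSup_le (eigSet_nonempty h) fun t ht => by
    have := eig_nonneg h2 (b - t) (by rw [mem_eig_sub']; simpa using ht)
    linarith
  have h4 : a ≤ lam3 A := le_csInf (eigSet_nonempty h) fun t ht => by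
    have := eig_nonneg h1 (t - a) (by rw [mem_eig_sub]; simpa using ht)
    linarith
  linarith

lemma trace_mul_nonneg' {A B : Mat3} (hA : A.PosSemidef) (hB : B.PosSemidef) :
    0 ≤ (A * B).trace := by
  obtain ⟨m, v, rfl⟩ := Matrix.posSemidef_iff_eq_sum_vecMulVec.1 hA
  rw [Finset.sum_mul, Matrix.trace_sum]
  refine Finset.sum_nonneg fun i _ => ?_
  rw [Matrix.vecMulVec_mul, Matrix.trace_vecMulVec, dotProduct_comm, ← Matrix.dotProduct_mulVec]
  exact hB.dotProduct_mulVec_nonneg _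

lemma vv_symm (v : Fin 3 → ℝ) : (vecMulVec v v).IsSymm := by
  rw [Matrix.IsSymm, Matrix.transpose_vecMulVec]

lemma vv_psd (v : Fin 3 → ℝ) : (vecMulVec v v).PosSemidef := by
  simpa using Matrix.posSemidef_vecMulVec_self_star v

lemma trace_mul_vv (n : Mat3) (v : Fin 3 → ℝ) : (n * vecMulVec v v).trace = v ⬝ᵥ n *ᵥ v := by
  rw [Matrix.mul_vecMulVec, Matrix.trace_vecMulVec, dotProduct_comm]

lemma symm_vecMul {n : Mat3} (h : n.IsSymm) (v : Fin 3 → ℝ) : v ᵥ* n = n *ᵥ v := by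
  rw [← Matrix.mulVec_transpose, h.eq]

/-- Deflation of a psd matrix along a unit eigenvector. -/
lemma deflate {D : Mat3} (hD : D.PosSemidef) (hs : D.IsSymm) {v : Fin 3 → ℝ} {c : ℝ}
    (hv : v ⬝ᵥ v = 1) (hDv : D *ᵥ v = c • v) : (D - c • vecMulVec v v).PosSemidef := by
  have h := hD.mul_mul_conjTranspose_same (1 - vecMulVec v v)
  convert h using 1
  rw [Matrix.conjTranspose_eq_transpose_of_trivial, Matrix.transpose_sub, (vv_symm v).eq,
    Matrix.transpose_one]
  simp only [sub_mul, mul_sub, one_mul, mul_one, Matrix.mul_vecMulVec, Matrix.vecMulVec_mul,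
    symm_vecMul hs, hDv, Matrix.smul_vecMulVec, Matrix.vecMulVec_smul, Matrix.vecMulVec_mulVec,
    Matrix.smul_mulVec, hv, MulOpposite.op_one, one_smul, sub_self, sub_zero]

lemma quad_scale (M : Mat3) (x : Fin 3 → ℝ)
    (h : ∀ r : ℝ, (r • x) ⬝ᵥ (r • x) = 1 → 0 ≤ (r • x) ⬝ᵥ M *ᵥ (r • x)) : 0 ≤ x ⬝ᵥ M *ᵥ x := by
  by_cases hx : x = 0
  · simp [hx]
  have hs : 0 < x ⬝ᵥ x := by
    have h0 : 0 ≤ x ⬝ᵥ x := by simpa using dotProduct_star_self_nonneg x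
    exact lt_of_le_of_ne h0 fun h1 => hx (dotProduct_self_eq_zero.1 h1.symm)
  have hr : 0 < (Real.sqrt (x ⬝ᵥ x))⁻¹ := inv_pos.2 (Real.sqrt_pos.2 hs)
  have := h (Real.sqrt (x ⬝ᵥ x))⁻¹ (by
    rw [smul_dotProduct, dotProduct_smul, smul_eq_mul, smul_eq_mul, ← mul_assoc, ← mul_inv,
      Real.mul_self_sqrt hs.le, inv_mul_cancel₀ hs.ne'])
  rw [Matrix.mulVec_smul, smul_dotProduct, dotProduct_smul, smul_eq_mul, smul_eq_mul] at this
  exact nonneg_of_mul_nonneg_right (nonneg_of_mul_nonneg_right this hr) hr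

lemma psd_of_quad {M : Mat3} (hs : M.IsSymm) (h : ∀ x : Fin 3 → ℝ, 0 ≤ x ⬝ᵥ M *ᵥ x) :
    M.PosSemidef :=
  .of_dotProduct_mulVec_nonneg (symm_herm hs) fun x => by simpa using h x

lemma one_sub_psd {v : Fin 3 → ℝ} (hv : v ⬝ᵥ v = 1) :
    ((1 : Mat3) - vecMulVec v v).PosSemidef := by
  simpa using deflate (D := 1) (c := 1) Matrix.PosSemidef.one Matrix.isSymm_one hv (by simp)

lemma one_sub_sub_psd {v w : Fin 3 → ℝ} (hv : v ⬝ᵥ v = 1) (hw : w ⬝ᵥ w = 1) (hvw : v ⬝ᵥ w = 0) :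
    ((1 : Mat3) - vecMulVec v v - vecMulVec w w).PosSemidef := by
  simpa using deflate (D := 1 - vecMulVec v v) (c := 1) (one_sub_psd hv)
    (Matrix.isSymm_one.sub (vv_symm v)) hw
    (by simp [Matrix.sub_mulVec, Matrix.vecMulVec_mulVec, hvw])

lemma sigma_eq {σ : Mat3} (hs : σ.IsSymm) (h12 : lam1 σ = lam2 σ) {k : ℝ}
    (hbd : lam1 σ - lam3 σ = 2 * k) {v : Fin 3 → ℝ} (hv : σ *ᵥ v = lam3 σ • v)
    (hu : v ⬝ᵥ v = 1) : σ = lam1 σ • (1 : Mat3) - (2 * k) • vecMulVec v v := by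
  have h := deflate (c := 2 * k) (psd_lam1 hs) ((symm_smul_one _).sub hs) hu (by
    rw [Matrix.sub_mulVec, hv, Matrix.smul_mulVec, Matrix.one_mulVec, ← sub_smul, hbd])
  have h0 := h.trace_eq_zero_iff.1 (by
    simp only [Matrix.trace_sub, Matrix.trace_smul, Matrix.trace_one, Matrix.trace_vecMulVec, hu]
    rw [lam2] at h12
    simp
    linarith)
  rw [sub_right_comm, sub_eq_zero] at h0
  exact h0.symm

lemma band_mem {k : ℝ} (hk : 0 < k) (a : ℝ) {Q : Mat3} (hs : Q.IsSymm) (h1 : Q.PosSemidef)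
    (h2 : (1 - Q).PosSemidef) :
    (a • (1 : Mat3) + (2 * k) • Q).IsSymm ∧
      lam1 (a • (1 : Mat3) + (2 * k) • Q) - lam3 (a • (1 : Mat3) + (2 * k) • Q) ≤ 2 * k := by
  have hs' : (a • (1 : Mat3) + (2 * k) • Q).IsSymm := (symm_smul_one a).add (hs.smul _)
  refine ⟨hs', ?_⟩
  have := band hs' (a := a) (b := a + 2 * k) (by
      rw [add_sub_cancel_left]; exact h1.smul (by positivity)) (by
      have := h2.smul (a := 2 * k) (by positivity)
      convert this using 1
      rw [smul_sub, add_smul]; abel)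
  linarith

/-- Normal cone of the Tresca domain at a boundary point with a double largest eigenvalue:
`N_{C_T}(σ) = {κ - tr(κ) v₃v₃ᵀ : κ symmetric positive semidefinite, κσ = σκ}`. -/
theorem stmt17 (k : ℝ) (hk : 0 < k)
    (C : Set Mat3) (hC : C = {τ : Mat3 | τ.IsSymm ∧ lam1 τ - lam3 τ ≤ 2 * k})
    (σ : Mat3) (hσsym : σ.IsSymm)
    (h12 : lam1 σ = lam2 σ) (h23 : lam3 σ < lam2 σ) (hσbd : lam1 σ - lam3 σ = 2 * k)
    (v₃ : Fin 3 → ℝ) (hv₃ : σ *ᵥ v₃ = lam3 σ • v₃) (hv₃u : v₃ ⬝ᵥ v₃ = 1) :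
    normalCone C σ =
      {x : Mat3 | ∃ κ : Mat3, κ.IsSymm ∧ κ.PosSemidef ∧ κ * σ = σ * κ ∧
        x = κ - κ.trace • vecMulVec v₃ v₃} := by
  have hσ := sigma_eq hσsym h12 hσbd hv₃ hv₃u
  have hvv : σ = lam3 σ • (1 : Mat3) + (2 * k) • (1 - vecMulVec v₃ v₃) := by
    conv_lhs => rw [hσ, show lam1 σ = lam3 σ + 2 * k by linarith]
    rw [add_smul, smul_sub]; abel
  have hk2 : (0 : ℝ) < 2 * k := by linarith
  ext n
  constructor
  · rintro ⟨hn, hn'⟩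
    have key : ∀ (a : ℝ) (Q : Mat3), Q.IsSymm → Q.PosSemidef → (1 - Q).PosSemidef →
        a * n.trace + 2 * k * ((n * Q).trace - n.trace + v₃ ⬝ᵥ n *ᵥ v₃) ≤ 0 := by
      intro a Q hs h1 h2
      have hm := band_mem hk (lam3 σ + a) hs h1 h2
      have := hn' ((lam3 σ + a) • (1 : Mat3) + (2 * k) • Q - σ)
        (subset_closure ⟨_, by rw [hC]; exact hm, 1, one_pos, by rw [one_smul]⟩)
      rw [show (lam3 σ + a) • (1 : Mat3) + (2 * k) • Q - σ =
        a • (1 : Mat3) + (2 * k) • (Q - 1 + vecMulVec v₃ v₃) by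
          generalize lam3 σ = l at hvv
          rw [hvv]
          simp only [add_smul, smul_sub, smul_add]; abel] at this
      simp only [minner, mul_add, mul_sub, Matrix.mul_smul, mul_one, Matrix.trace_add,
        Matrix.trace_smul, Matrix.trace_sub, trace_mul_vv, smul_eq_mul] at this
      linarith
    have key1 : ∀ Q : Mat3, Q.IsSymm → Q.PosSemidef → (1 - Q).PosSemidef →
        (n * Q).trace - n.trace + v₃ ⬝ᵥ n *ᵥ v₃ ≤ 0 := by
      intro Q hs h1 h2
      have := key 0 Q hs h1 h2
      rw [zero_mul, zero_add] at this
      exact nonpos_of_mul_nonpos_right this hk2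
    have htr : n.trace = 0 := by
      have hQ := (Matrix.isSymm_one (n := Fin 3) (α := ℝ)).sub (vv_symm v₃)
      have e1 := key 1 (1 - vecMulVec v₃ v₃) hQ (one_sub_psd hv₃u)
        (by rw [sub_sub_cancel]; exact vv_psd _)
      have e2 := key (-1) (1 - vecMulVec v₃ v₃) hQ (one_sub_psd hv₃u)
        (by rw [sub_sub_cancel]; exact vv_psd _)
      simp only [mul_sub, mul_one, Matrix.trace_sub, trace_mul_vv] at e1 e2
      linarith
    set μ := v₃ ⬝ᵥ n *ᵥ v₃ with hμ
    have hpsd : (n - μ • (1 : Mat3)).PosSemidef := by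
      refine psd_of_quad (hn.sub (symm_smul_one _)) fun x => quad_scale _ x fun r hr => ?_
      have := key1 (1 - vecMulVec (r • x) (r • x)) (Matrix.isSymm_one.sub (vv_symm _))
        (one_sub_psd hr) (by rw [sub_sub_cancel]; exact vv_psd _)
      simp only [mul_sub, mul_one, Matrix.trace_sub, trace_mul_vv] at this
      rw [Matrix.sub_mulVec, Matrix.smul_mulVec, Matrix.one_mulVec, dotProduct_sub,
        dotProduct_smul, hr, smul_eq_mul, mul_one]
      linarith
    have hnv : n *ᵥ v₃ = μ • v₃ := by
      have := (hpsd.dotProduct_mulVec_zero_iff v₃).1 (by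
        rw [star_trivial, Matrix.sub_mulVec, Matrix.smul_mulVec, Matrix.one_mulVec, dotProduct_sub,
          dotProduct_smul, hv₃u, smul_eq_mul, mul_one, ← hμ, sub_self])
      rwa [Matrix.sub_mulVec, Matrix.smul_mulVec, Matrix.one_mulVec, sub_eq_zero] at this
    have hperp : ∀ w : Fin 3 → ℝ, v₃ ⬝ᵥ w = 0 → 0 ≤ w ⬝ᵥ n *ᵥ w := by
      intro w hw
      refine quad_scale n w fun r hr => ?_
      have := key1 (1 - vecMulVec v₃ v₃ - vecMulVec (r • w) (r • w))
        ((Matrix.isSymm_one.sub (vv_symm _)).sub (vv_symm _))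
        (one_sub_sub_psd hv₃u hr (by rw [dotProduct_smul, hw, smul_zero]))
        (by rw [sub_sub, sub_sub_cancel]; exact (vv_psd _).add (vv_psd _))
      simp only [mul_sub, mul_one, Matrix.trace_sub, trace_mul_vv] at this
      linarith
    have hκs : (n - μ • vecMulVec v₃ v₃).IsSymm := hn.sub ((vv_symm _).smul _)
    have hκv : (n - μ • vecMulVec v₃ v₃) *ᵥ v₃ = 0 := by
      simp [Matrix.sub_mulVec, Matrix.smul_mulVec, Matrix.vecMulVec_mulVec, hv₃u, hnv]
    refine ⟨n - μ • vecMulVec v₃ v₃, hκs, ?_, ?_, ?_⟩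
    · refine psd_of_quad hκs fun x => ?_
      obtain ⟨s, w, hw, rfl⟩ : ∃ (s : ℝ) (w : Fin 3 → ℝ), v₃ ⬝ᵥ w = 0 ∧ x = w + s • v₃ :=
        ⟨v₃ ⬝ᵥ x, x - (v₃ ⬝ᵥ x) • v₃, by simp [dotProduct_sub, hv₃u], by simp⟩
      have e : v₃ ⬝ᵥ (n - μ • vecMulVec v₃ v₃) *ᵥ w = 0 := by
        rw [Matrix.dotProduct_mulVec, symm_vecMul hκs, hκv, zero_dotProduct]
      rw [Matrix.mulVec_add, Matrix.mulVec_smul, hκv, smul_zero, add_zero, add_dotProduct,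
        smul_dotProduct, e, smul_zero, add_zero]
      have := hperp w hw
      simpa [Matrix.sub_mulVec, Matrix.smul_mulVec, Matrix.vecMulVec_mulVec, hw] using this
    · rw [hσ]
      generalize n - μ • vecMulVec v₃ v₃ = κ at hκs hκv
      simp [mul_sub, sub_mul, Matrix.mul_vecMulVec, Matrix.vecMulVec_mul, symm_vecMul hκs, hκv]
    · simp [Matrix.trace_sub, htr, Matrix.trace_vecMulVec, hv₃u]
  · rintro ⟨κ, hκs, hκ, hcomm, rfl⟩
    refine ⟨hκs.sub ((vv_symm _).smul _), ?_⟩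
    set c := v₃ ⬝ᵥ κ *ᵥ v₃ with hc
    have hκv : κ *ᵥ v₃ = c • v₃ := by
      rw [hσ] at hcomm
      simp only [mul_sub, sub_mul, Matrix.mul_smul, Matrix.smul_mul, mul_one, one_mul,
        sub_right_inj] at hcomm
      have h1 := smul_right_injective _ hk2.ne' hcomm
      have h2 := congrArg (fun M : Mat3 => M *ᵥ v₃) h1
      simp only [← Matrix.mulVec_mulVec, Matrix.vecMulVec_mulVec, hv₃u, ← hc] at h2
      simpa using h2
    have hdef := deflate hκ hκs hv₃u hκv
    suffices hsub : tangentCone C σ ⊆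
        {τ | minner (κ - κ.trace • vecMulVec v₃ v₃) τ ≤ 0} from fun τ hτ => hsub hτ
    refine closure_minimal ?_ (isClosed_le ?_ continuous_const)
    · rintro τ ⟨η, hη, α, hα, rfl⟩
      rw [hC] at hη
      obtain ⟨hηs, hηb⟩ := hη
      have e1 := trace_mul_nonneg' hdef (psd_lam1 hηs)
      have e2 := trace_mul_nonneg' (vv_psd v₃) (psd_lam3 hηs)
      have e3 := hdef.trace_nonneg
      rw [Matrix.trace_mul_comm, trace_mul_vv] at e2
      have hx : ((vecMulVec v₃ v₃) * η).trace = v₃ ⬝ᵥ η *ᵥ v₃ := by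
        rw [Matrix.trace_mul_comm, trace_mul_vv]
      have hvs : ((vecMulVec v₃ v₃) * vecMulVec v₃ v₃).trace = 1 := by
        rw [trace_mul_vv, Matrix.vecMulVec_mulVec, hv₃u]; simp [hv₃u]
      have htv : (vecMulVec v₃ v₃).trace = 1 := by rw [Matrix.trace_vecMulVec, hv₃u]
      show minner _ _ ≤ 0
      rw [minner, Matrix.mul_smul, Matrix.trace_smul, smul_eq_mul]
      refine mul_nonpos_of_nonneg_of_nonpos hα.le ?_
      rw [hσ]
      simp only [mul_sub, sub_mul, Matrix.mul_smul, Matrix.smul_mul, mul_one, Matrix.trace_sub,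
        Matrix.trace_smul, smul_eq_mul, hx, hvs, htv, trace_mul_vv, ← hc, Matrix.sub_mulVec,
        Matrix.smul_mulVec, Matrix.one_mulVec, dotProduct_sub, dotProduct_smul, hv₃u] at e1 e2 e3 ⊢
      nlinarith [mul_nonneg e3 e2, mul_nonneg e3 (sub_nonneg.2 hηb)]
    · unfold minner
      fun_prop
end
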